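/- arXiv:1208.3991 — 2 statements merged into one kernel-verified Lean document; each statement's English description precedes it below -/
import Mathlib

section
/- Let X be a compact metric space with a uniquely ergodic homeomorphism T with invariant measure μ, and let (f_n) be a continuous subadditive cocycle over T with Lyapunov exponent Λ(f) = inf_n (1/n)∫ f_n dμ. Then for every ε > 0 there exists N such that for all n ≥ N and all x ∈ X, (1/n) f_n(x) < Λ(f) + ε. -/
open MeasureTheory

lemma furman_birkhoff_upper
    {X : Type*} [MetricSpace X] [CompactSpace X] [MeasurableSpace X] [BorelSpace X]
    (T : X ≃ₜ X) (μ : Measure X) 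
    (huniq : ∀ ν : Measure X, IsProbabilityMeasure ν → MeasurePreserving T ν ν → ν = μ)
    (g : X → ℝ) (hg : Continuous g) (δ : ℝ) (hδ : 0 < δ) :
    ∃ N : ℕ, ∀ n ≥ N, ∀ x, birkhoffSum T g (n+1) x < ((n:ℝ)+1) * ((∫ x, g x ∂μ) + δ) := by
  by_contra! hcon
  choose u hu z hz using hcon
  -- bad sequence
  let m : ∀ n : ℕ, ProbabilityMeasure X := fun n =>
    ⟨((u n : ENNReal) + 1)⁻¹ • ∑ j ∈ Finset.range (u n + 1), Measure.dirac ((⇑T)^[j] (z n)), by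
      constructor
      simp only [Measure.smul_apply, Measure.finsetSum_apply, measure_univ, Finset.sum_const,
        Finset.card_range, smul_eq_mul, nsmul_eq_mul, mul_one]
      push_cast
      apply ENNReal.inv_mul_cancel
      · simp
      · simp⟩
  have hm : ∀ n (φ : BoundedContinuousFunction X ℝ), ∫ x, φ x ∂(m n : Measure X)
      = ((u n : ℝ) + 1)⁻¹ * birkhoffSum T φ (u n + 1) (z n) := by
    intro n φ
    show ∫ x, φ x ∂(((u n : ENNReal) + 1)⁻¹ • ∑ j ∈ Finset.range (u n + 1),
      Measure.dirac ((⇑T)^[j] (z n))) = _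
    rw [integral_smul_measure, integral_finsetSum_measure]
    · simp only [integral_dirac, birkhoffSum, smul_eq_mul]
      congr 1
      rw [ENNReal.toReal_inv, ENNReal.toReal_add (by simp) (by simp)]
      simp
    · intro i _
      exact φ.integrable _
  have hinf : Filter.Tendsto u Filter.atTop Filter.atTop :=
    Filter.tendsto_atTop_mono hu Filter.tendsto_id
  let U : Ultrafilter ℕ := Ultrafilter.of Filter.atTop
  have hU : (U : Filter ℕ) ≤ Filter.atTop := Ultrafilter.of_le _
  obtain ⟨ν, hν⟩ : ∃ ν, Filter.Tendsto m U (nhds ν) :=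
    ⟨(U.map m).lim, (U.map m).le_nhds_lim⟩
  rw [ProbabilityMeasure.tendsto_iff_forall_integral_tendsto] at hν
  have hinvν : MeasurePreserving T (ν : Measure X) (ν : Measure X) := by
    refine ⟨T.continuous.measurable, ?_⟩
    haveI : IsProbabilityMeasure (Measure.map T (ν : Measure X)) :=
      Measure.isProbabilityMeasure_map T.continuous.measurable.aemeasurable
    apply ext_of_forall_integral_eq_of_IsFiniteMeasure
    intro φ
    rw [integral_map T.continuous.measurable.aemeasurable
      φ.continuous.aestronglyMeasurable]
    have h1 := hν (φ.compContinuous ⟨T, T.continuous⟩)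
    have h2 := hν φ
    have h3 := h1.sub h2
    have h4 : Filter.Tendsto (fun n => ((u n : ℝ) + 1)⁻¹ * (2 * ‖φ‖)) U (nhds 0) := by
      have : Filter.Tendsto (fun n => ((u n : ℝ) + 1)⁻¹) Filter.atTop (nhds 0) := by
        apply Filter.Tendsto.inv_tendsto_atTop
        exact Filter.tendsto_atTop_add_const_right _ _
          (tendsto_natCast_atTop_atTop.comp hinf)
      simpa using (this.mono_left hU).mul_const (2 * ‖φ‖)
    have h5 := squeeze_zero_norm (f := fun n => ∫ x, (φ.compContinuous ⟨T, T.continuous⟩) x ∂(m n : Measure X) - ∫ x, φ x ∂(m n : Measure X)) (fun n => ?_) h4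
    · have := tendsto_nhds_unique h3 h5
      exact sub_eq_zero.1 this
    · show ‖∫ x, (φ.compContinuous ⟨T, T.continuous⟩) x ∂(m n : Measure X) - ∫ x, φ x ∂(m n : Measure X)‖ ≤ _
      rw [hm, hm, ← mul_sub, norm_mul, Real.norm_of_nonneg (by positivity : (0:ℝ) ≤ ((u n : ℝ) + 1)⁻¹)]
      apply mul_le_mul_of_nonneg_left _ (by positivity)
      have : birkhoffSum T (φ.compContinuous ⟨T, T.continuous⟩) (u n + 1) (z n)
          = birkhoffSum T φ (u n + 1) (T (z n)) := by
        unfold birkhoffSum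
        apply Finset.sum_congr rfl
        intro j _
        simp only [BoundedContinuousFunction.compContinuous_apply, ContinuousMap.coe_mk]
        rw [← Function.iterate_succ_apply' (⇑T), Function.iterate_succ_apply]
      rw [this, birkhoffSum_apply_sub_birkhoffSum]
      refine (norm_sub_le _ _).trans ?_
      have := φ.norm_coe_le_norm ((⇑T)^[u n + 1] (z n))
      have := φ.norm_coe_le_norm (z n)
      linarith
  have heq := huniq ν inferInstance hinvν
  have h := hν (BoundedContinuousFunction.mkOfCompact ⟨g, hg⟩)
  rw [heq] at h
  have : (∫ x, g x ∂μ) + δ ≤ ∫ x, g x ∂μ := by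
    refine ge_of_tendsto' h (fun n => ?_)
    rw [hm]
    have := hz n
    rw [inv_mul_eq_div, le_div_iff₀ (by positivity), mul_comm]
    exact this
  linarith

lemma furman_comb {X : Type*} (T : X → X) (f : ℕ → X → ℝ) 
    (hsub : ∀ n m, 1 ≤ n → 1 ≤ m → ∀ x, f (n + m) x ≤ f n x + f m (T^[n] x))
    (k : ℕ) (hk : 1 ≤ k) (B : ℝ) (hB : ∀ i ≤ k, ∀ x, |f i x| ≤ B) (m : ℕ) (hm : 1 ≤ m) (x : X) :
    k * f (m + k) x ≤ birkhoffSum T (f k) m x + 2 * k * B := by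
  have key : ∀ m x, ∑ i ∈ Finset.range k, f (m + k - i) (T^[i] x)
      ≤ birkhoffSum T (f k) m x + k * B := by
    intro m
    induction m with
    | zero =>
      intro x
      rw [birkhoffSum_zero, zero_add]
      calc _ ≤ ∑ i ∈ Finset.range k, B :=
            Finset.sum_le_sum fun i _ => (le_abs_self _).trans (hB _ (by omega) _)
        _ = _ := by simp
    | succ m ih =>
      intro x
      have h1 := ih (T x)
      have h2 : ∑ i ∈ Finset.range k, f (m + k - i) (T^[i] (T x))
          = ∑ i ∈ Finset.range k, f (m + 1 + k - (i+1)) (T^[i+1] x) := by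
        apply Finset.sum_congr rfl
        intro i _
        rw [Function.iterate_succ_apply]
        congr 1
        omega
      have h3 := Finset.sum_range_succ (fun i => f (m + 1 + k - i) (T^[i] x)) k
      have h4 := Finset.sum_range_succ' (fun i => f (m + 1 + k - i) (T^[i] x)) k
      have h5 := hsub k (m+1) hk (by omega) x
      rw [birkhoffSum_succ']
      simp only [Nat.add_sub_cancel, Nat.sub_zero, Function.iterate_zero, id] at h3 h4
      rw [add_comm k (m+1)] at h5
      linarith
  have h1 : ∑ i ∈ Finset.range k, f (m + k) x
      ≤ ∑ i ∈ Finset.range k, (f (m + k - i) (T^[i] x) + B) := by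
    apply Finset.sum_le_sum
    intro i hi
    rw [Finset.mem_range] at hi
    rcases Nat.eq_zero_or_pos i with rfl | hi0
    · have := (abs_nonneg _).trans (hB 0 (by omega) x)
      simpa using this
    · have h := hsub i (m + k - i) hi0 (by omega) x
      rw [show i + (m + k - i) = m + k by omega] at h
      have := (le_abs_self _).trans (hB i hi.le x)
      linarith
  rw [Finset.sum_add_distrib] at h1
  simp only [Finset.sum_const, Finset.card_range, nsmul_eq_mul] at h1
  have := key m x
  linarith

/-- Furman's theorem: for a uniquely ergodic homeomorphism `T` of a compact metric space `X`
with unique invariant probability measure `μ`, and a continuous subadditive cocycle `(f_n)`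
with Lyapunov exponent `Λ(f) = inf_n (1/n) ∫ f_n dμ`, for every `ε > 0` there is `N` such
that `(1/n) f_n(x) < Λ(f) + ε` for all `n ≥ N` and all `x ∈ X`. -/
theorem furman_uniform_convergence
    {X : Type*} [MetricSpace X] [CompactSpace X] [MeasurableSpace X] [BorelSpace X]
    (T : X ≃ₜ X) (μ : Measure X) [IsProbabilityMeasure μ]
    (hinv : MeasurePreserving T μ μ)
    (huniq : ∀ ν : Measure X, IsProbabilityMeasure ν → MeasurePreserving T ν ν → ν = μ)
    (f : ℕ → X → ℝ) (hcont : ∀ n, Continuous (f n))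
    (hsub : ∀ n m, 1 ≤ n → 1 ≤ m → ∀ x, f (n + m) x ≤ f n x + f m ((⇑T)^[n] x)) :
    ∀ ε > (0 : ℝ), ∃ N : ℕ, ∀ n ≥ N, ∀ x : X,
      f n x / n < (⨅ k : ℕ+, (∫ x, f k x ∂μ) / k) + ε := by
  intro ε hε
  set L : ℝ := ⨅ k : ℕ+, (∫ x, f k x ∂μ) / k with hL
  obtain ⟨k, hk⟩ : ∃ k : ℕ+, (∫ x, f k x ∂μ) / k < L + ε / 2 := by
    by_cases hb : BddBelow (Set.range fun k : ℕ+ => (∫ x, f k x ∂μ) / (k : ℝ))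
    · exact exists_lt_of_ciInf_lt (by rw [← hL]; linarith)
    · rw [not_bddBelow_iff] at hb
      obtain ⟨_, ⟨k, rfl⟩, hk⟩ := hb (L + ε / 2)
      exact ⟨k, hk⟩
  set a : ℝ := ∫ x, f k x ∂μ with ha
  have hk1 : 1 ≤ (k : ℕ) := k.pos
  have hkR : (0 : ℝ) < ((k : ℕ) : ℝ) := by exact_mod_cast k.pos
  generalize hK : (k : ℕ) = K at *
  have hbd : ∀ i, ∃ C, ∀ x, |f i x| ≤ C := fun i => by
    obtain ⟨C, hC⟩ := isCompact_univ.exists_bound_of_continuousOn (hcont i).continuousOn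
    exact ⟨C, fun x => hC x trivial⟩
  choose C hC using hbd
  have hB : ∀ i ≤ K, ∀ x, |f i x| ≤ ∑ i ∈ Finset.range (K + 1), |C i| := by
    intro i hi x
    refine ((hC i x).trans (le_abs_self _)).trans ?_
    exact Finset.single_le_sum (f := fun i => |C i|) (fun i _ => abs_nonneg _)
      (Finset.mem_range.2 (by omega))
  generalize (∑ i ∈ Finset.range (K + 1), |C i|) = B at hB
  obtain ⟨N0, hN0⟩ := furman_birkhoff_upper T μ huniq (f K) (hcont K) (K * ε / 4) (by positivity)
  rw [← ha] at hN0
  set b := a + K * ε / 4 with hb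
  obtain ⟨N1, hN1⟩ := exists_nat_gt ((2 * K * B + K * |b|) / (K * ε / 4))
  refine ⟨N0 + K + 1 + N1, fun n hn x => ?_⟩
  obtain ⟨m, rfl⟩ : ∃ m, n = m + 1 + K := ⟨n - 1 - K, by omega⟩
  have h1 := furman_comb T f hsub K hk1 B hB (m + 1) (by omega) x
  have h2 := hN0 m (by omega) x
  rw [div_lt_iff₀ (by positivity)] at hN1
  rw [div_lt_iff₀ hkR] at hk
  have hnR : (N1 : ℝ) ≤ ((m + 1 + K : ℕ) : ℝ) := by exact_mod_cast (by omega : N1 ≤ m + 1 + K)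
  have hnpos : (0 : ℝ) < ((m + 1 + K : ℕ) : ℝ) := by positivity
  rw [div_lt_iff₀ hnpos]
  have hm1 : (m : ℝ) + 1 = ((m + 1 + K : ℕ) : ℝ) - K := by push_cast; ring
  rw [hm1] at h2
  generalize ((m + 1 + K : ℕ) : ℝ) = n at *
  have h3 : (N1 : ℝ) * (K * ε / 4) ≤ n * (K * ε / 4) := by gcongr
  have h4 : -(K * b) ≤ K * |b| := by
    have := mul_le_mul_of_nonneg_left (neg_le_abs b) hkR.le
    linarith
  have h5 : n * a < n * ((L + ε / 2) * K) := mul_lt_mul_of_pos_left hk hnpos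
  have h6 : n * b = n * a + n * (K * ε / 4) := by rw [hb]; ring
  have h7 : K * f (m + 1 + K) x < K * ((L + ε) * n) := by nlinarith
  exact lt_of_mul_lt_mul_left h7 hkR.le
end

section
/- Let f : ℝ/ℤ → ℝ be γ-Hölder continuous with 0 < γ ≤ 1, and let S(ω) = ∪_θ σ(h_{ω,θ}) denote the union over phases of the spectra of the operators (h_{ω,θ}u)(n) = u(n+1) + u(n−1) + f(θ + nω)u(n). Then there is a constant C_f > 0 such that for all ω, ω' with |ω − ω'| small enough: for every E ∈ S(ω) there exists E' ∈ S(ω') with |E − E'| ≤ C_f |ω − ω'|^{γ/(1+γ)}. -/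
/-- `h` is the Schrödinger operator on `ℓ²(ℤ)` with potential `n ↦ f(θ + nω)`:
`(hψ)(n) = ψ(n+1) + ψ(n−1) + f(θ + nω)ψ(n)`. -/
def IsSchrodingerOp (f : ℝ → ℝ) (ω θ : ℝ)
    (h : lp (fun _ : ℤ => ℝ) 2 →L[ℝ] lp (fun _ : ℤ => ℝ) 2) : Prop :=
  ∀ (ψ : lp (fun _ : ℤ => ℝ) 2) (n : ℤ),
    h ψ n = ψ (n + 1) + ψ (n - 1) + f (θ + n * ω) * ψ n

/-- `S(ω) = ⋃_θ σ(h_{ω,θ})`, the union over phases of the spectra. -/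
def unionSpectrum (f : ℝ → ℝ) (ω : ℝ) : Set ℝ :=
  {E | ∃ (θ : ℝ) (h : lp (fun _ : ℤ => ℝ) 2 →L[ℝ] lp (fun _ : ℤ => ℝ) 2),
    IsSchrodingerOp f ω θ h ∧ E ∈ spectrum ℝ h}


section Spectral
variable {H : Type*} [NormedAddCommGroup H] [InnerProductSpace ℝ H] 

lemma aux_not_isUnit (B : H →L[ℝ] H) (hB : ∀ x y, inner ℝ (B x) y = inner ℝ x (B y))
    (hb : 0 < ‖B‖) : ¬ IsUnit (B * B - (‖B‖ ^ 2) • (1 : H →L[ℝ] H)) := by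
  rintro ⟨u, hu⟩
  set b := ‖B‖ with hbdef
  set V : H →L[ℝ] H := ↑u⁻¹ with hV
  set K := ‖V‖ + 1 with hK
  have hK0 : 0 < K := by positivity
  have h1 : ∀ x, ‖x‖ ≤ K * ‖B (B x) - (b ^ 2) • x‖ := by
    intro x
    have : V ((u : H →L[ℝ] H) x) = x := by
      rw [← mul_apply_eq_comp, hV, Units.inv_mul]; rfl
    have h2 : (u : H →L[ℝ] H) x = B (B x) - (b ^ 2) • x := by rw [hu]; simp
    calc ‖x‖ = ‖V (B (B x) - (b ^ 2) • x)‖ := by rw [← h2, this]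
      _ ≤ ‖V‖ * _ := V.le_opNorm _
      _ ≤ _ := by gcongr; linarith
  have h3 : ∀ x, ‖B (B x) - (b ^ 2) • x‖ ^ 2 ≤ b ^ 2 * (b ^ 2 * ‖x‖ ^ 2 - ‖B x‖ ^ 2) := by
    intro x
    have e1 : inner ℝ (B (B x)) x = ‖B x‖ ^ 2 := by
      rw [hB, real_inner_self_eq_norm_sq]
    have e2 : ‖B (B x)‖ ≤ b * ‖B x‖ := B.le_opNorm _
    have e3 : ‖B (B x)‖ ^ 2 ≤ b ^ 2 * ‖B x‖ ^ 2 := by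
      rw [← mul_pow]; gcongr
    rw [norm_sub_sq_real, inner_smul_right, e1, norm_smul]
    have : ‖b ^ 2‖ = b ^ 2 := by rw [Real.norm_eq_abs, abs_of_nonneg (by positivity)]
    rw [this]
    nlinarith
  set s := 1 / (K ^ 2 * b ^ 2) with hs
  have hs0 : 0 < s := by positivity
  have h4 : ∀ x, ‖B x‖ ≤ Real.sqrt (b ^ 2 - s) * ‖x‖ := by
    intro x
    have h5 : ‖x‖ ^ 2 ≤ K ^ 2 * b ^ 2 * (b ^ 2 * ‖x‖ ^ 2 - ‖B x‖ ^ 2) := by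
      calc ‖x‖ ^ 2 ≤ (K * ‖B (B x) - (b ^ 2) • x‖) ^ 2 := by gcongr; exact h1 x
        _ = K ^ 2 * ‖B (B x) - (b ^ 2) • x‖ ^ 2 := by ring
        _ ≤ K ^ 2 * (b ^ 2 * (b ^ 2 * ‖x‖ ^ 2 - ‖B x‖ ^ 2)) := by gcongr; exact h3 x
        _ = _ := by ring
    have h6 : s * ‖x‖ ^ 2 ≤ b ^ 2 * ‖x‖ ^ 2 - ‖B x‖ ^ 2 := by
      rw [hs, div_mul_eq_mul_div, one_mul, div_le_iff₀ (by positivity)]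
      linarith
    have h7 : ‖B x‖ ^ 2 ≤ (b ^ 2 - s) * ‖x‖ ^ 2 := by linarith
    have h8 := Real.le_sqrt_of_sq_le h7
    rwa [Real.sqrt_mul' _ (by positivity), Real.sqrt_sq (norm_nonneg _)] at h8
  have h9 : b ≤ Real.sqrt (b ^ 2 - s) := B.opNorm_le_bound (Real.sqrt_nonneg _) h4
  rw [Real.le_sqrt' hb] at h9
  linarith

lemma aux_exists_spectrum (B : H →L[ℝ] H) (hB : ∀ x y, inner ℝ (B x) y = inner ℝ x (B y))
    (hb : 0 < ‖B‖) : ∃ l ∈ spectrum ℝ B, |l| = ‖B‖ := by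
  by_contra! hcon
  have h1 : ‖B‖ ∉ spectrum ℝ B := fun h => hcon _ h (abs_of_pos hb)
  have h2 : -‖B‖ ∉ spectrum ℝ B := fun h => hcon _ h (by rw [abs_neg, abs_of_pos hb])
  rw [spectrum.notMem_iff] at h1 h2
  apply aux_not_isUnit B hB hb
  have : B * B - (‖B‖ ^ 2) • (1 : H →L[ℝ] H) =
      (algebraMap ℝ (H →L[ℝ] H) ‖B‖ - B) * (algebraMap ℝ (H →L[ℝ] H) (-‖B‖) - B) := by
    ext x
    simp only [pow_two, Algebra.algebraMap_eq_smul_one, sub_apply, mul_apply_eq_comp, smul_apply, one_apply_eq_self, map_sub, map_smul, mul_smul]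
    module
  rw [this]
  exact h1.mul h2

lemma aux_near_spectrum (T : H →L[ℝ] H) (hT : ∀ x y, inner ℝ (T x) y = inner ℝ x (T y))
    (E r : ℝ) (x : H) (hx : x ≠ 0) (h : ‖T x - E • x‖ ≤ r * ‖x‖) :
    ∃ E' ∈ spectrum ℝ T, |E - E'| ≤ r := by
  have hx0 : 0 < ‖x‖ := norm_pos_iff.2 hx
  have hr : 0 ≤ r := by
    by_contra! hr
    nlinarith [norm_nonneg (T x - E • x)]
  by_cases hE : E ∈ spectrum ℝ T
  · exact ⟨E, hE, by simpa using hr⟩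
  rw [spectrum.notMem_iff] at hE
  obtain ⟨u, hu⟩ := hE
  set V : H →L[ℝ] H := ↑u⁻¹ with hV
  have hux : ∀ y, (u : H →L[ℝ] H) y = E • y - T y := by
    intro y; rw [hu]; simp [Algebra.algebraMap_eq_smul_one]
  have hVu : ∀ y, V ((u : H →L[ℝ] H) y) = y := by
    intro y; rw [← mul_apply_eq_comp, hV, Units.inv_mul]; rfl
  have huV : ∀ y, (u : H →L[ℝ] H) (V y) = y := by
    intro y; rw [← mul_apply_eq_comp, hV, Units.mul_inv]; rfl
  have husym : ∀ y z, inner ℝ ((u : H →L[ℝ] H) y) z = inner ℝ y ((u : H →L[ℝ] H) z) := by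
    intro y z
    rw [hux, hux, inner_sub_left, inner_sub_right, inner_smul_left, inner_smul_right, hT]; simp
  have hVsym : ∀ y z, inner ℝ (V y) z = inner ℝ y (V z) := by
    intro y z
    conv_lhs => rw [← huV z]
    rw [← husym, huV]
  have hn : ‖x‖ ≤ ‖V‖ * (r * ‖x‖) := by
    calc ‖x‖ = ‖V ((u : H →L[ℝ] H) x)‖ := by rw [hVu]
      _ ≤ ‖V‖ * ‖(u : H →L[ℝ] H) x‖ := V.le_opNorm _
      _ ≤ _ := by rw [hux, norm_sub_rev]; gcongr
  have hn1 : 1 ≤ ‖V‖ * r := by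
    by_contra! hc
    nlinarith
  have hV0 : 0 < ‖V‖ := by
    by_contra! hc
    nlinarith [norm_nonneg V]
  obtain ⟨l, hl, hlV⟩ := aux_exists_spectrum V hVsym hV0
  have hl0 : l ≠ 0 := by
    rintro rfl
    simp at hlV; rw [← hlV] at hV0; simp at hV0
  have h2 : l⁻¹ ∈ spectrum ℝ (u : H →L[ℝ] H) := by
    have := (spectrum.inv_mem_iff (R := ℝ) (r := Units.mk0 l hl0) (a := u⁻¹)).1 hl
    simpa using this
  refine ⟨E - l⁻¹, ?_, ?_⟩
  · rw [spectrum.mem_iff] at h2 ⊢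
    intro h3
    apply h2
    rw [hu]
    convert h3.neg using 1
    rw [map_sub]; abel
  · have : E - (E - l⁻¹) = l⁻¹ := by ring
    rw [this, abs_inv, hlV, inv_le_iff_one_le_mul₀ hV0]
    linarith

lemma aux_approx [CompleteSpace H] (T : H →L[ℝ] H) (hT : ∀ x y, inner ℝ (T x) y = inner ℝ x (T y))
    (E : ℝ) (hE : E ∈ spectrum ℝ T) (d : ℝ) (hd : 0 < d) :
    ∃ x : H, ‖T x - E • x‖ < d * ‖x‖ := by
  by_contra! hcon
  rw [spectrum.mem_iff] at hE
  apply hE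
  set A := algebraMap ℝ (H →L[ℝ] H) E - T with hA
  have hAx : ∀ y, A y = E • y - T y := by
    intro y; rw [hA]; simp [Algebra.algebraMap_eq_smul_one]
  have hAsym : ∀ y z, inner ℝ (A y) z = inner ℝ y (A z) := by
    intro y z
    rw [hAx, hAx, inner_sub_left, inner_sub_right, inner_smul_left, inner_smul_right, hT]; simp
  have : IsUnit (A * A) := by
    refine ContinuousLinearMap.isUnit_of_forall_le_norm_inner_map (𝕜 := ℝ) (A * A)
      (c := ⟨d ^ 2, by positivity⟩) (by change (0:ℝ) < d ^ 2; positivity) ?_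
    intro x
    rw [mul_apply_eq_comp, hAsym, real_inner_self_eq_norm_sq, Real.norm_eq_abs,
      abs_of_nonneg (by positivity)]
    have := hcon x
    rw [norm_sub_rev, ← hAx] at this
    change ‖x‖ ^ 2 * d ^ 2 ≤ _
    rw [← mul_pow, mul_comm]
    gcongr
  exact ((Commute.refl A).isUnit_mul_iff.1 this).1

end Spectral

abbrev Ltwo := lp (fun _ : ℤ => ℝ) 2

lemma aux_hasSum_sq (x : Ltwo) : HasSum (fun n => x n ^ 2) (‖x‖ ^ 2) := by
  have := lp.hasSum_inner (𝕜 := ℝ) x x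
  rw [real_inner_self_eq_norm_sq] at this
  simpa [pow_two] using this

lemma aux_ennreal (x : Ltwo) : ENNReal.ofReal (‖x‖ ^ 2) = ∑' n, ENNReal.ofReal (x n ^ 2) := by
  rw [← (aux_hasSum_sq x).tsum_eq]
  exact ENNReal.ofReal_tsum_of_nonneg (fun n => sq_nonneg _) (aux_hasSum_sq x).summable

lemma aux_norm_le (x y : Ltwo) (c : ℝ) (hc : 0 ≤ c) (h : ∀ n, |x n| ≤ c * |y n|) :
    ‖x‖ ≤ c * ‖y‖ := by
  have h1 : ‖x‖ ^ 2 ≤ c ^ 2 * ‖y‖ ^ 2 := by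
    refine hasSum_le (fun n => ?_) (aux_hasSum_sq x) ((aux_hasSum_sq y).mul_left (c ^ 2))
    rw [← sq_abs (x n), ← sq_abs (y n), ← mul_pow]
    gcongr
    exact h n
  rw [← mul_pow] at h1
  exact le_of_sq_le_sq h1 (by positivity)

lemma aux_mul (d : ℤ → ℝ) (c : ℝ) (hc : ∀ n, |d n| ≤ c) :
    ∃ D : Ltwo →L[ℝ] Ltwo, ∀ (x : Ltwo) (n : ℤ), D x n = d n * x n := by
  have hc0 : 0 ≤ c := (abs_nonneg _).trans (hc 0)
  have hmem : ∀ x : Ltwo, Memℓp (fun n => d n * x n) 2 := by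
    intro x
    refine Memℓp.mono' (F := fun _ => ℝ) (g := fun n => c * x n) ((lp.memℓp x).const_mul c) ?_
    intro n
    rw [norm_mul, norm_mul]
    gcongr
    exact (hc n).trans (le_abs_self c)
  let D0 : Ltwo →ₗ[ℝ] Ltwo :=
    { toFun := fun x => ⟨fun n => d n * x n, hmem x⟩
      map_add' := by
        intro x y; ext n; exact mul_add _ _ _
      map_smul' := by
        intro a x; ext n; exact mul_left_comm _ _ _ }
  refine ⟨D0.mkContinuous c ?_, ?_⟩
  · intro x
    apply aux_norm_le _ _ _ hc0
    intro n
    change |d n * x n| ≤ _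
    rw [abs_mul]
    gcongr
    exact hc n
  · intro x n; rfl

lemma aux_symm {f : ℝ → ℝ} {ω θ : ℝ} {h : Ltwo →L[ℝ] Ltwo} (hh : IsSchrodingerOp f ω θ h)
    (x y : Ltwo) : inner ℝ (h x) y = inner ℝ x (h y) := by
  have H1 : HasSum (fun n : ℤ => h x n * y n - x n * h y n)
      (inner ℝ (h x) y - inner ℝ x (h y)) := by
    have a := lp.hasSum_inner (𝕜 := ℝ) (h x) y
    have b := lp.hasSum_inner (𝕜 := ℝ) x (h y)
    simpa [mul_comm] using a.sub b
  -- summability of shifted products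
  have hs : ∀ u v : Ltwo, Summable (fun n : ℤ => u (n + 1) * v n) := by
    intro u v
    have su : Summable (fun n : ℤ => u (n + 1) ^ 2) :=
      (Equiv.addRight (1 : ℤ)).summable_iff.2 (aux_hasSum_sq u).summable
    have sv := (aux_hasSum_sq v).summable
    refine Summable.of_norm_bounded (su.add sv) ?_
    intro n
    rw [Real.norm_eq_abs, abs_le]
    constructor <;> nlinarith [sq_nonneg (u (n+1) - v n), sq_nonneg (u (n+1) + v n)]
  obtain ⟨a, ha⟩ := hs x y
  obtain ⟨b, hb⟩ := hs y x
  have ha' : HasSum (fun n : ℤ => x n * y (n - 1)) a := by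
    have := (Equiv.subRight (1 : ℤ)).hasSum_iff.2 ha
    simpa [Function.comp_def] using this
  have hb' : HasSum (fun n : ℤ => y n * x (n - 1)) b := by
    have := (Equiv.subRight (1 : ℤ)).hasSum_iff.2 hb
    simpa [Function.comp_def] using this
  have H2 := (ha.add hb').sub (hb.add ha')
  have H3 : HasSum (fun n : ℤ => h x n * y n - x n * h y n) (a + b - (b + a)) := by
    refine H2.congr_fun ?_
    intro n
    rw [hh, hh]; ring
  have := H1.unique H3
  linarith

lemma aux_conv (F v : ℤ → ENNReal) :
    ∑' j : ℤ, ∑' n : ℤ, F (n - j) * v n = (∑' m, F m) * ∑' n, v n := by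
  rw [ENNReal.tsum_comm, ← ENNReal.tsum_mul_left]
  refine tsum_congr fun n => ?_
  rw [ENNReal.tsum_mul_right]
  congr 1
  exact (Equiv.subLeft n).tsum_eq F

/-- tent function -/
noncomputable def tent (M : ℕ) (m : ℤ) : ℝ := max 0 (2 * (M : ℝ) - |(m : ℝ)|)

lemma tent_nonneg (M : ℕ) (m : ℤ) : 0 ≤ tent M m := le_max_left _ _

lemma tent_le (M : ℕ) (m : ℤ) : tent M m ≤ 2 * M :=
  max_le (by positivity) (by linarith [abs_nonneg (m : ℝ)])

lemma tent_zero (M : ℕ) (m : ℤ) (h : 2 * (M : ℤ) ≤ |m|) : tent M m = 0 := by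
  have : (2 * (M : ℝ)) ≤ |(m : ℝ)| := by exact_mod_cast h
  exact max_eq_left (by linarith)

lemma tent_diff (M : ℕ) (m : ℤ) : (tent M (m + 1) - tent M m) ^ 2 ≤ 1 := by
  rw [sq_le_one_iff_abs_le_one]
  unfold tent
  rw [max_comm 0, max_comm 0]
  refine (abs_max_sub_max_le_abs _ _ _).trans ?_
  push_cast
  have h1 := abs_abs_sub_abs_le (m : ℝ) (m + 1)
  have e : (2 * (M : ℝ) - |(m : ℝ) + 1| - (2 * M - |(m : ℝ)|)) = |(m : ℝ)| - |(m : ℝ) + 1| := by ring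
  rw [e]
  refine h1.trans ?_
  simp

lemma tent_A (M : ℕ) : ∃ a : ℝ, (M : ℝ) ^ 3 ≤ a ∧
    ∑' m, ENNReal.ofReal (tent M m ^ 2) = ENNReal.ofReal a := by
  refine ⟨∑ m ∈ Finset.Icc (-(2 * M : ℤ)) (2 * M), tent M m ^ 2, ?_, ?_⟩
  · calc (M : ℝ) ^ 3 = ∑ m ∈ Finset.Ico (0 : ℤ) M, (M : ℝ) ^ 2 := by simp; ring
      _ ≤ ∑ m ∈ Finset.Ico (0 : ℤ) M, tent M m ^ 2 := by
        refine Finset.sum_le_sum fun m hm => ?_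
        rw [Finset.mem_Ico] at hm
        have h0 : (0 : ℝ) ≤ m := by exact_mod_cast hm.1
        have h1 : (m : ℝ) ≤ M := by exact_mod_cast hm.2.le
        gcongr
        refine le_max_of_le_right ?_
        rw [abs_of_nonneg h0]; linarith
      _ ≤ _ := by
        refine Finset.sum_le_sum_of_subset_of_nonneg ?_ fun _ _ _ => sq_nonneg _
        intro m hm
        rw [Finset.mem_Ico] at hm
        rw [Finset.mem_Icc]
        omega
  · rw [ENNReal.ofReal_sum_of_nonneg fun _ _ => sq_nonneg _]
    refine tsum_eq_sum fun m hm => ?_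
    rw [Finset.mem_Icc] at hm
    rw [tent_zero M m (by rw [le_abs]; omega)]; simp

lemma tent_B (M : ℕ) : ∃ b : ℝ, 0 ≤ b ∧ b ≤ 4 * M ∧
    ∑' m, ENNReal.ofReal ((tent M (m + 1) - tent M m) ^ 2) = ENNReal.ofReal b := by
  refine ⟨∑ m ∈ Finset.Ico (-(2 * M : ℤ)) (2 * M), (tent M (m + 1) - tent M m) ^ 2,
    Finset.sum_nonneg fun _ _ => sq_nonneg _, ?_, ?_⟩
  · calc _ ≤ ∑ m ∈ Finset.Ico (-(2 * M : ℤ)) (2 * M), (1 : ℝ) :=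
          Finset.sum_le_sum fun m _ => tent_diff M m
      _ = 4 * M := by
        rw [Finset.sum_const, Int.card_Ico, nsmul_eq_mul, mul_one]
        have : ((2 * M : ℤ) - -(2 * M)).toNat = 4 * M := by omega
        rw [this]; push_cast; ring
  · rw [ENNReal.ofReal_sum_of_nonneg fun _ _ => sq_nonneg _]
    refine tsum_eq_sum fun m hm => ?_
    rw [Finset.mem_Ico] at hm
    rw [tent_zero M m (by rw [le_abs]; omega), tent_zero M (m + 1) (by rw [le_abs]; omega)]; simp

lemma tent_B' (M : ℕ) : ∑' m, ENNReal.ofReal ((tent M (m - 1) - tent M m) ^ 2) =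
    ∑' m, ENNReal.ofReal ((tent M (m + 1) - tent M m) ^ 2) := by
  rw [← (Equiv.addRight (1 : ℤ)).tsum_eq]
  refine tsum_congr fun m => ?_
  simp only [Equiv.coe_addRight, add_sub_cancel_right]
  congr 1; ring

lemma aux_localize {f : ℝ → ℝ} {ω θ : ℝ} {h : Ltwo →L[ℝ] Ltwo} (hh : IsSchrodingerOp f ω θ h)
    (E : ℝ) (hE : E ∈ spectrum ℝ h) (M : ℕ) (hM : 0 < M) :
    ∃ (j : ℤ) (x : Ltwo), (∀ n, x n ≠ 0 → |n - j| < 2 * (M : ℤ)) ∧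
      ‖h x - E • x‖ < 6 / M * ‖x‖ := by
  have hM0 : (0 : ℝ) < M := by exact_mod_cast hM
  obtain ⟨y, hy⟩ := aux_approx h (aux_symm hh) E hE (1 / M) (by positivity)
  have hy0 : 0 < ‖y‖ := by
    by_contra! hc
    have : ‖y‖ = 0 := le_antisymm hc (norm_nonneg _)
    rw [this, mul_zero] at hy
    exact absurd hy (not_lt.2 (norm_nonneg _))
  have hD : ∀ j : ℤ, ∃ x : Ltwo, ∀ n, x n = tent M (n - j) * y n := by
    intro j
    obtain ⟨D, hD⟩ := aux_mul (fun n => tent M (n - j)) (2 * M)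
      (fun n => by rw [abs_of_nonneg (tent_nonneg _ _)]; exact tent_le _ _)
    exact ⟨D y, hD y⟩
  choose x hx using hD
  by_contra! hcon
  have hcon1 : ∀ j, 36 / (M : ℝ) ^ 2 * ‖x j‖ ^ 2 ≤ ‖h (x j) - E • x j‖ ^ 2 := by
    intro j
    have h1 := hcon j (x j) (by
      intro n hn
      by_contra! hc
      apply hn
      rw [hx, tent_zero M _ hc, zero_mul])
    calc 36 / (M : ℝ) ^ 2 * ‖x j‖ ^ 2 = (6 / M * ‖x j‖) ^ 2 := by ring
      _ ≤ _ := by gcongr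
  set z : Ltwo := h y - E • y with hz
  have hzn : ∀ n, z n = y (n + 1) + y (n - 1) + f (θ + n * ω) * y n - E * y n := by
    intro n
    rw [← hh y n]; rfl
  obtain ⟨a, ha, hA⟩ := tent_A M
  obtain ⟨b, hb0, hb, hB⟩ := tent_B M
  have ha0 : 0 ≤ a := le_trans (by positivity) ha
  set N := ENNReal.ofReal (‖y‖ ^ 2) with hN
  set X := ENNReal.ofReal (‖z‖ ^ 2) with hX
  have L1 : ∑' j, ENNReal.ofReal (36 / (M : ℝ) ^ 2 * ‖x j‖ ^ 2) =
      ENNReal.ofReal (36 / (M : ℝ) ^ 2) * (ENNReal.ofReal a * N) := by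
    rw [← hA, hN, aux_ennreal y, ← aux_conv, ← ENNReal.tsum_mul_left]
    refine tsum_congr fun j => ?_
    rw [ENNReal.ofReal_mul (by positivity), aux_ennreal]
    congr 1
    refine tsum_congr fun n => ?_
    rw [hx, mul_pow, ENNReal.ofReal_mul (sq_nonneg _)]
  have S1 : ∑' n, ENNReal.ofReal (y (n + 1) ^ 2) = N := by
    rw [hN, aux_ennreal y]
    exact (Equiv.addRight (1 : ℤ)).tsum_eq fun n => ENNReal.ofReal (y n ^ 2)
  have S2 : ∑' n, ENNReal.ofReal (y (n - 1) ^ 2) = N := by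
    rw [hN, aux_ennreal y]
    exact (Equiv.subRight (1 : ℤ)).tsum_eq fun n => ENNReal.ofReal (y n ^ 2)
  have L2 : ∑' j, ENNReal.ofReal (‖h (x j) - E • x j‖ ^ 2) ≤
      3 * (ENNReal.ofReal a * X + ENNReal.ofReal b * N + ENNReal.ofReal b * N) := by
    nth_rewrite 2 [← S2]
    rw [← S1, ← hA]
    nth_rewrite 2 [← hB]
    rw [← hB, ← tent_B' M]
    nth_rewrite 1 [tent_B' M]
    rw [hX, aux_ennreal z]
    rw [← aux_conv, ← aux_conv (fun m => ENNReal.ofReal ((tent M (m + 1) - tent M m) ^ 2)),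
      ← aux_conv (fun m => ENNReal.ofReal ((tent M (m - 1) - tent M m) ^ 2)),
      ← ENNReal.tsum_add, ← ENNReal.tsum_add, ← ENNReal.tsum_mul_left]
    refine ENNReal.tsum_le_tsum fun j => ?_
    rw [aux_ennreal, ← ENNReal.tsum_add, ← ENNReal.tsum_add, ← ENNReal.tsum_mul_left]
    refine ENNReal.tsum_le_tsum fun n => ?_
    have e3 : (3 : ENNReal) = ENNReal.ofReal 3 := by simp
    rw [e3, ← ENNReal.ofReal_mul (sq_nonneg _), ← ENNReal.ofReal_mul (sq_nonneg _),
      ← ENNReal.ofReal_mul (sq_nonneg _), ← ENNReal.ofReal_add (by positivity) (by positivity),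
      ← ENNReal.ofReal_add (by positivity) (by positivity), ← ENNReal.ofReal_mul (by norm_num)]
    refine ENNReal.ofReal_le_ofReal ?_
    have e : (h (x j) - E • x j : Ltwo) n = tent M (n - j) * z n
        + (tent M (n - j + 1) - tent M (n - j)) * y (n + 1)
        + (tent M (n - j - 1) - tent M (n - j)) * y (n - 1) := by
      have : (h (x j) - E • x j : Ltwo) n = h (x j) n - E * x j n := rfl
      rw [this, hh, hzn, hx, hx, hx, show n + 1 - j = n - j + 1 by ring,
        show n - 1 - j = n - j - 1 by ring]
      ring
    rw [e, ← mul_pow, ← mul_pow, ← mul_pow]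
    generalize tent M (n - j) * z n = p
    generalize (tent M (n - j + 1) - tent M (n - j)) * y (n + 1) = q
    generalize (tent M (n - j - 1) - tent M (n - j)) * y (n - 1) = r
    nlinarith [sq_nonneg (p - q), sq_nonneg (p - r), sq_nonneg (q - r)]
  have L3 := (L1.symm.le.trans
    (ENNReal.tsum_le_tsum fun j => ENNReal.ofReal_le_ofReal (hcon1 j))).trans L2
  have e3 : (3 : ENNReal) = ENNReal.ofReal 3 := by simp
  rw [e3, hN, hX, ← ENNReal.ofReal_mul ha0, ← ENNReal.ofReal_mul ha0, ← ENNReal.ofReal_mul hb0,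
      ← ENNReal.ofReal_add (by positivity) (by positivity),
      ← ENNReal.ofReal_add (by positivity) (by positivity), ← ENNReal.ofReal_mul (p := 3) (by norm_num),
      ← ENNReal.ofReal_mul (by positivity), ENNReal.ofReal_le_ofReal_iff (by positivity)] at L3
  have hz2 : ‖z‖ ^ 2 ≤ 1 / (M : ℝ) ^ 2 * ‖y‖ ^ 2 := by
    calc ‖z‖ ^ 2 ≤ (1 / M * ‖y‖) ^ 2 := by gcongr
      _ = _ := by ring
  have hY : 0 < ‖y‖ ^ 2 := by positivity
  have h5 : 36 / (M : ℝ) ^ 2 * (a * ‖y‖ ^ 2) ≤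
      3 * (a * (1 / (M : ℝ) ^ 2 * ‖y‖ ^ 2) + 4 * M * ‖y‖ ^ 2 + 4 * M * ‖y‖ ^ 2) := by
    refine L3.trans ?_
    gcongr
  have h6 : 36 * a ≤ 3 * a + 24 * M ^ 3 := by
    have e1 : 36 / (M : ℝ) ^ 2 * (a * ‖y‖ ^ 2) = (36 * a) * (‖y‖ ^ 2 / M ^ 2) := by
      field_simp
    have e2 : 3 * (a * (1 / (M : ℝ) ^ 2 * ‖y‖ ^ 2) + 4 * M * ‖y‖ ^ 2 + 4 * M * ‖y‖ ^ 2) =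
        (3 * a + 24 * M ^ 3) * (‖y‖ ^ 2 / M ^ 2) := by
      field_simp; ring
    rw [e1, e2] at h5
    exact le_of_mul_le_mul_right h5 (by positivity)
  have : 0 < (M : ℝ) ^ 3 := by positivity
  linarith

lemma aux_bdd (f : ℝ → ℝ) (γ Cf : ℝ) (hγ0 : 0 < γ) (hCf : 0 ≤ Cf)
    (hper : Function.Periodic f 1)
    (hHolder : ∀ x y : ℝ, |f x - f y| ≤ Cf * |x - y| ^ γ) (x y : ℝ) : |f x - f y| ≤ 2 * Cf := by
  have key : ∀ x, |f x - f 0| ≤ Cf := by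
    intro x
    have h1 : f x = f (Int.fract x) := by
      have := hper.sub_int_mul_eq (x := x) ⌊x⌋
      rw [← this, mul_one]; rfl
    rw [h1]
    refine (hHolder _ _).trans ?_
    have h2 : |Int.fract x - 0| ^ γ ≤ 1 := by
      refine Real.rpow_le_one (abs_nonneg _) ?_ hγ0.le
      rw [sub_zero, abs_of_nonneg (Int.fract_nonneg x)]
      exact (Int.fract_lt_one x).le
    nlinarith
  have h1 := key x
  have h2 := key y
  rw [abs_le] at *
  constructor <;> linarith

/-- `γ/(1+γ)`-Hölder continuity of the spectrum in the frequency: if `f` is `1`-periodic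
and `γ`-Hölder (`0 < γ ≤ 1`), then there is `C_f > 0` (depending only on `f`) such that for
all `ω, ω'` close enough, every `E ∈ S(ω)` has `E' ∈ S(ω')` with
`|E − E'| ≤ C_f |ω − ω'|^{γ/(1+γ)}`. -/
theorem spectrum_holder_continuity_in_frequency
    (f : ℝ → ℝ) (γ Cf : ℝ) (hγ0 : 0 < γ) (hγ1 : γ ≤ 1) (hCf : 0 ≤ Cf)
    (hper : Function.Periodic f 1)
    (hHolder : ∀ x y : ℝ, |f x - f y| ≤ Cf * |x - y| ^ γ) :
    ∃ C > (0 : ℝ), ∃ ε > (0 : ℝ), ∀ ω ω' : ℝ, |ω - ω'| < ε →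
      ∀ E ∈ unionSpectrum f ω, ∃ E' ∈ unionSpectrum f ω',
        |E - E'| ≤ C * |ω - ω'| ^ (γ / (1 + γ)) := by
  refine ⟨6 + 4 * Cf, by positivity, 1, one_pos, ?_⟩
  rintro ω ω' hε E ⟨θ, h, hh, hE⟩
  set s := γ / (1 + γ) with hs
  have hs0 : 0 < s := by positivity
  rcases eq_or_ne ω ω' with rfl | hne
  · refine ⟨E, ⟨θ, h, hh, hE⟩, ?_⟩
    simp [Real.zero_rpow hs0.ne']
  set d := |ω - ω'| with hd
  have hd0 : 0 < d := abs_pos.2 (sub_ne_zero.2 hne)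
  have hds : 1 ≤ d ^ (-s) := Real.one_le_rpow_of_pos_of_le_one_of_nonpos hd0 hε.le (by linarith)
  set M := ⌈d ^ (-s)⌉₊ with hMdef
  have hM1 : d ^ (-s) ≤ M := Nat.le_ceil _
  have hM2 : (M : ℝ) ≤ 2 * d ^ (-s) := by
    have := Nat.ceil_lt_add_one (a := d ^ (-s)) (by positivity)
    linarith
  have hM0 : (0 : ℝ) < M := by linarith
  obtain ⟨j, x, hsupp, hx⟩ := aux_localize hh E hE M (by exact_mod_cast hM0)
  have hx0 : x ≠ 0 := by
    rintro rfl
    simp at hx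
  set θ' := θ + j * ω - j * ω' with hθ'
  obtain ⟨D, hD⟩ := aux_mul (fun n => f (θ' + n * ω') - f (θ + n * ω)) (2 * Cf)
    (fun n => aux_bdd f γ Cf hγ0 hCf hper hHolder _ _)
  have hh' : IsSchrodingerOp f ω' θ' (h + D) := by
    intro y n
    have : (h + D) y n = h y n + D y n := rfl
    rw [this, hh, hD]; ring
  have hDx : ‖D x‖ ≤ (4 * Cf * d ^ s) * ‖x‖ := by
    refine aux_norm_le _ _ _ (by positivity) fun n => ?_
    rw [hD, abs_mul]
    by_cases hn : x n = 0
    · simp [hn]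
    gcongr
    refine (hHolder _ _).trans ?_
    have e : θ' + n * ω' - (θ + n * ω) = -((n - j : ℤ) : ℝ) * (ω - ω') := by
      rw [hθ']; push_cast; ring
    have h1 : |((n - j : ℤ) : ℝ)| ≤ 2 * M := by exact_mod_cast (hsupp n hn).le
    have h2 : |θ' + n * ω' - (θ + n * ω)| ≤ 4 * d ^ (1 - s) := by
      rw [e, abs_mul, abs_neg]
      calc |((n - j : ℤ) : ℝ)| * |ω - ω'| ≤ (2 * (2 * d ^ (-s))) * d := by
            gcongr
            linarith
        _ = 4 * (d ^ (-s) * d ^ (1 : ℝ)) := by rw [Real.rpow_one]; ring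
        _ = _ := by rw [← Real.rpow_add hd0]; ring_nf
    have h3 : |θ' + n * ω' - (θ + n * ω)| ^ γ ≤ 4 * d ^ s := by
      calc _ ≤ (4 * d ^ (1 - s)) ^ γ := by gcongr
        _ = 4 ^ γ * d ^ s := by
          rw [Real.mul_rpow (by norm_num) (by positivity), ← Real.rpow_mul hd0.le]
          congr 2
          rw [hs]; field_simp; ring
        _ ≤ 4 ^ (1 : ℝ) * d ^ s := by gcongr; norm_num
        _ = _ := by rw [Real.rpow_one]
    calc _ ≤ Cf * (4 * d ^ s) := by gcongr
      _ = _ := by ring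
  have h6 : 6 / (M : ℝ) ≤ 6 * d ^ s := by
    rw [div_le_iff₀ hM0]
    have : d ^ s * d ^ (-s) = 1 := by rw [← Real.rpow_add hd0]; simp
    have h7 : d ^ s * d ^ (-s) ≤ d ^ s * M := by gcongr
    linarith
  obtain ⟨E', hE', hEE⟩ := aux_near_spectrum (h + D) (aux_symm hh') E ((6 + 4 * Cf) * d ^ s) x hx0 (by
    have e : (h + D) x - E • x = (h x - E • x) + D x := by
      rw [add_apply]; abel
    rw [e]
    calc _ ≤ ‖h x - E • x‖ + ‖D x‖ := norm_add_le _ _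
      _ ≤ 6 / M * ‖x‖ + (4 * Cf * d ^ s) * ‖x‖ := by gcongr
      _ ≤ 6 * d ^ s * ‖x‖ + (4 * Cf * d ^ s) * ‖x‖ := by gcongr
      _ = _ := by ring)
  exact ⟨E', ⟨θ', h + D, hh', hE'⟩, hEE⟩
end
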